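/- Let m > 0, and for each α ∈ (0, m) let f_{m,α} denote the unique density solution to the equation x^m f(x) = (1/Γ(α)) ∫_0^x (x−v)^{α−1} f(v) dv on (0,∞). Then for every fixed s > −m, the Mellin transform converges to 1 as α → 0+: lim_{α→0+} ∫_0^∞ x^{−s} f_{m,α}(x) dx = 1. (Thus the random variable X_{m,α} with density f_{m,α} converges in distribution to the constant 1 as α → 0.) -/

import Mathlib

open MeasureTheory Real Set Filter

noncomputable section

/-- `f` is a density solution to the integro-differential equation
`I^α_{0+} f = x^m f` on `(0,∞)`: `f` is measurable, nonnegative on `(0,∞)`,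
integrates to `1` on `(0,∞)`, and satisfies
`x^m f(x) = (1/Γ(α)) ∫_0^x (x−v)^{α−1} f(v) dv` for every `x > 0`. -/
def IsDensitySolution (α m : ℝ) (f : ℝ → ℝ) : Prop :=
  Measurable f ∧ (∀ x ∈ Set.Ioi (0:ℝ), 0 ≤ f x) ∧
  (∫ x in Set.Ioi (0:ℝ), f x) = 1 ∧
  ∀ x ∈ Set.Ioi (0:ℝ),
    x ^ m * f x = (1 / Real.Gamma α) * ∫ v in Set.Ioo (0:ℝ) x, (x - v) ^ (α - 1) * f v


section Tonelli

theorem lintegral_Ioi_eq_lintegral_Ioi_zero_add (v : ℝ) (h : ℝ → ENNReal) :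
    ∫⁻ x in Ioi v, h x = ∫⁻ y in Ioi (0:ℝ), h (y + v) := by
  rw [← lintegral_indicator measurableSet_Ioi, ← lintegral_indicator measurableSet_Ioi,
    ← lintegral_add_right_eq_self _ v]
  refine lintegral_congr fun y => ?_
  by_cases hy : 0 < y
  · rw [indicator_of_mem (by simpa using hy), indicator_of_mem (by simpa using hy)]
  · rw [indicator_of_notMem (by simpa using hy), indicator_of_notMem (by simpa using hy)]

/-- Tonelli's theorem for a weighted one-sided convolution. -/
theorem lintegral_mul_lintegral_Ioo_convolution {W k g : ℝ → ENNReal}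
    (hW : Measurable W) (hk : Measurable k) (hg : Measurable g) :
    ∫⁻ x in Ioi (0:ℝ), W x * ∫⁻ v in Ioo (0:ℝ) x, k (x - v) * g v =
      ∫⁻ v in Ioi (0:ℝ), g v * ∫⁻ y in Ioi (0:ℝ), W (y + v) * k y := by
  have hS : MeasurableSet {p : ℝ × ℝ | 0 < p.2 ∧ p.2 < p.1} :=
    (measurableSet_lt measurable_const measurable_snd).inter
      (measurableSet_lt measurable_snd measurable_fst)
  set F : ℝ × ℝ → ENNReal := indicator {p : ℝ × ℝ | 0 < p.2 ∧ p.2 < p.1}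
    (fun p => W p.1 * (k (p.1 - p.2) * g p.2)) with hF
  have hFm : Measurable F := by
    refine Measurable.indicator ?_ hS
    fun_prop
  have h1 : ∫⁻ x in Ioi (0:ℝ), W x * ∫⁻ v in Ioo (0:ℝ) x, k (x - v) * g v =
      ∫⁻ x, ∫⁻ v, F (x, v) := by
    rw [← lintegral_indicator measurableSet_Ioi]
    refine lintegral_congr fun x => ?_
    by_cases hx : x ∈ Ioi (0:ℝ)
    · rw [indicator_of_mem hx, ← lintegral_const_mul _ (by fun_prop),
        ← lintegral_indicator measurableSet_Ioo]
      rfl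
    · rw [indicator_of_notMem hx, eq_comm, lintegral_eq_zero_iff (by fun_prop)]
      refine Eventually.of_forall fun v => ?_
      refine indicator_of_notMem ?_ _
      rintro ⟨h, h'⟩
      exact hx (h.trans h')
  have h2 : ∫⁻ v in Ioi (0:ℝ), g v * ∫⁻ y in Ioi (0:ℝ), W (y + v) * k y =
      ∫⁻ v, ∫⁻ x, F (x, v) := by
    rw [← lintegral_indicator measurableSet_Ioi]
    refine lintegral_congr fun v => ?_
    by_cases hv : v ∈ Ioi (0:ℝ)
    · have := lintegral_Ioi_eq_lintegral_Ioi_zero_add v (fun x => W x * k (x - v))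
      simp only [add_sub_cancel_right] at this
      rw [indicator_of_mem hv, ← this, ← lintegral_const_mul _ (by fun_prop),
        ← lintegral_indicator measurableSet_Ioi]
      refine lintegral_congr fun x => ?_
      by_cases hx : v < x
      · rw [indicator_of_mem (by simpa using hx), hF, indicator_of_mem (by exact ⟨hv, hx⟩)]
        ring
      · rw [indicator_of_notMem (by simpa using hx), hF,
          indicator_of_notMem (fun h => hx h.2)]
    · rw [indicator_of_notMem hv, eq_comm, lintegral_eq_zero_iff (by fun_prop)]
      refine Eventually.of_forall fun x => ?_
      exact indicator_of_notMem (fun h => hv h.1) _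
  rw [h1, h2]
  exact lintegral_lintegral_swap (f := fun x v => F (x, v)) hFm.aemeasurable

end Tonelli

section Beta

theorem lintegral_rpow_mul_exp_neg_mul_Ioi {a r : ℝ} (ha : 0 < a) (hr : 0 < r) :
    ∫⁻ y in Ioi (0:ℝ), ENNReal.ofReal (y ^ (a - 1) * exp (-(r * y))) =
      ENNReal.ofReal (r ^ (-a) * Gamma a) := by
  have h := Real.integral_rpow_mul_exp_neg_mul_Ioi ha hr
  have hpos : 0 < (1 / r) ^ a * Gamma a := by
    have := Gamma_pos_of_pos ha
    positivity
  rw [← ofReal_integral_eq_lintegral_ofReal (Integrable.of_integral_ne_zero (h ▸ hpos.ne')), h,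
    one_div, inv_rpow hr.le, rpow_neg hr.le]
  refine (ae_restrict_iff' measurableSet_Ioi).2 (Eventually.of_forall fun y hy => ?_)
  have : 0 < y := hy
  simp only [Pi.zero_apply]
  positivity

/-- The Beta integral over a half-line, in terms of Gamma functions. -/
theorem lintegral_add_rpow_neg_mul_rpow_Ioi {a b v : ℝ} (ha : 0 < a) (hb : 0 < b) (hv : 0 < v) :
    ∫⁻ y in Ioi (0:ℝ), ENNReal.ofReal ((y + v) ^ (-(a + b))) * ENNReal.ofReal (y ^ (a - 1)) =
      ENNReal.ofReal (Gamma a * Gamma b / Gamma (a + b) * v ^ (-b)) := by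
  have hab : 0 < a + b := by positivity
  have hG := Gamma_pos_of_pos hab
  have hGa := Gamma_pos_of_pos ha
  have hGb := Gamma_pos_of_pos hb
  set F : ℝ → ℝ → ENNReal := fun y z => ENNReal.ofReal
    (z ^ (a + b - 1) * exp (-((y + v) * z)) * y ^ (a - 1)) with hF
  have hl : ∀ y ∈ Ioi (0:ℝ), ENNReal.ofReal (Gamma (a + b)) *
      (ENNReal.ofReal ((y + v) ^ (-(a + b))) * ENNReal.ofReal (y ^ (a - 1))) =
      ∫⁻ z in Ioi (0:ℝ), F y z := by
    intro y hy
    have hy : 0 < y := hy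
    have hyv : 0 < y + v := by positivity
    rw [← mul_assoc, ← ENNReal.ofReal_mul hG.le, mul_comm (Gamma (a + b)),
      ← lintegral_rpow_mul_exp_neg_mul_Ioi hab hyv, ← lintegral_mul_const _ (by fun_prop)]
    refine setLIntegral_congr_fun measurableSet_Ioi fun z hz => ?_
    have hz : 0 < z := hz
    simp only [hF]
    rw [← ENNReal.ofReal_mul (by positivity)]
  have hr : ∀ z ∈ Ioi (0:ℝ), ∫⁻ y in Ioi (0:ℝ), F y z =
      ENNReal.ofReal (z ^ (b - 1) * exp (-(v * z))) * ENNReal.ofReal (Gamma a) := by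
    intro z hz
    have hz : 0 < z := hz
    have e : ∀ y ∈ Ioi (0:ℝ), F y z = ENNReal.ofReal (z ^ (a + b - 1) * exp (-(v * z))) *
        ENNReal.ofReal (y ^ (a - 1) * exp (-(z * y))) := by
      intro y hy
      rw [← ENNReal.ofReal_mul (by positivity)]
      simp only [hF]
      congr 1
      rw [show -((y + v) * z) = -(v * z) + -(z * y) by ring, exp_add]
      ring
    rw [setLIntegral_congr_fun measurableSet_Ioi e, lintegral_const_mul _ (by fun_prop),
      lintegral_rpow_mul_exp_neg_mul_Ioi ha hz, ← ENNReal.ofReal_mul (by positivity),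
      ← ENNReal.ofReal_mul (by positivity)]
    congr 1
    rw [show b - 1 = (a + b - 1) + (-a) by ring, rpow_add hz]
    ring
  have hmain : ENNReal.ofReal (Gamma (a + b)) *
      ∫⁻ y in Ioi (0:ℝ), ENNReal.ofReal ((y + v) ^ (-(a + b))) * ENNReal.ofReal (y ^ (a - 1)) =
      ENNReal.ofReal (v ^ (-b) * Gamma b) * ENNReal.ofReal (Gamma a) := by
    rw [← lintegral_const_mul _ (by fun_prop), setLIntegral_congr_fun measurableSet_Ioi hl,
      lintegral_lintegral_swap (by simp only [hF, Function.uncurry_def]; fun_prop),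
      setLIntegral_congr_fun measurableSet_Ioi hr, lintegral_mul_const _ (by fun_prop),
      lintegral_rpow_mul_exp_neg_mul_Ioi hb hv]
  have hG0 : ENNReal.ofReal (Gamma (a + b)) ≠ 0 := by simpa using hG
  rw [← ENNReal.mul_right_inj hG0 ENNReal.ofReal_ne_top, hmain, ← ENNReal.ofReal_mul hG.le,
    ← ENNReal.ofReal_mul (by positivity)]
  congr 1
  field_simp

end Beta

namespace IsDensitySolution

variable {α m : ℝ} {f : ℝ → ℝ}

theorem lintegral_eq_one (h : IsDensitySolution α m f) :
    ∫⁻ x in Ioi (0:ℝ), ENNReal.ofReal (f x) = 1 := by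
  obtain ⟨-, hf0, hf1, -⟩ := h
  rw [← ofReal_integral_eq_lintegral_ofReal
    (Integrable.of_integral_ne_zero (by rw [hf1]; exact one_ne_zero))
    ((ae_restrict_iff' measurableSet_Ioi).2 (Eventually.of_forall hf0)), hf1, ENNReal.ofReal_one]

/-- The fractional integral of a density solution is finite almost everywhere. -/
theorem ae_lintegral_Ioo_lt_top (h : IsDensitySolution α m f) (hα : 0 < α) :
    ∀ᵐ x ∂(volume.restrict (Ioi (0:ℝ))),
      ∫⁻ v in Ioo (0:ℝ) x, ENNReal.ofReal ((x - v) ^ (α - 1)) * ENNReal.ofReal (f v) < ⊤ := by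
  have hfm := h.1
  have hW : Measurable fun x : ℝ => ENNReal.ofReal (exp (-x)) := by fun_prop
  have hk : Measurable fun x : ℝ => ENNReal.ofReal (x ^ (α - 1)) := by fun_prop
  have hg : Measurable fun x : ℝ => ENNReal.ofReal (f x) := by fun_prop
  have key := lintegral_mul_lintegral_Ioo_convolution hW hk hg
  have hinner : ∀ v ∈ Ioi (0:ℝ), ENNReal.ofReal (f v) * ∫⁻ y in Ioi (0:ℝ),
      ENNReal.ofReal (exp (-(y + v))) * ENNReal.ofReal (y ^ (α - 1)) ≤
      ENNReal.ofReal (f v) * ENNReal.ofReal (Gamma α) := by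
    intro v hv
    have hv : 0 < v := hv
    gcongr
    have := lintegral_rpow_mul_exp_neg_mul_Ioi hα one_pos
    rw [one_rpow, one_mul] at this
    rw [← this]
    refine setLIntegral_mono (by fun_prop) fun y hy => ?_
    have hy : 0 < y := hy
    rw [← ENNReal.ofReal_mul (by positivity), mul_comm]
    gcongr
    linarith
  have hfin : ∫⁻ x in Ioi (0:ℝ), ENNReal.ofReal (exp (-x)) *
      ∫⁻ v in Ioo (0:ℝ) x, ENNReal.ofReal ((x - v) ^ (α - 1)) * ENNReal.ofReal (f v) ≠ ⊤ := by
    rw [key]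
    refine ne_top_of_le_ne_top ?_ (setLIntegral_mono (by fun_prop) hinner)
    rw [lintegral_mul_const _ hg, h.lintegral_eq_one, one_mul]
    exact ENNReal.ofReal_ne_top
  have hmeas : Measurable fun x : ℝ =>
      ∫⁻ v in Ioo (0:ℝ) x, ENNReal.ofReal ((x - v) ^ (α - 1)) * ENNReal.ofReal (f v) := by
    have hS : MeasurableSet {p : ℝ × ℝ | 0 < p.2 ∧ p.2 < p.1} :=
      (measurableSet_lt measurable_const measurable_snd).inter
        (measurableSet_lt measurable_snd measurable_fst)
    have : Measurable (indicator {p : ℝ × ℝ | 0 < p.2 ∧ p.2 < p.1} fun p : ℝ × ℝ =>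
        ENNReal.ofReal ((p.1 - p.2) ^ (α - 1)) * ENNReal.ofReal (f p.2)) :=
      Measurable.indicator (by fun_prop) hS
    convert this.lintegral_prod_right' (ν := volume) using 2 with x
    rw [← lintegral_indicator measurableSet_Ioo]
    rfl
  filter_upwards [ae_lt_top (hW.mul hmeas) hfin] with x hx
  by_contra htop
  rw [not_lt_top_iff] at htop
  simp [htop, ENNReal.mul_top, exp_pos] at hx

theorem ae_ofReal_rpow_mul_eq (h : IsDensitySolution α m f) (hα : 0 < α) :
    ∀ᵐ x ∂(volume.restrict (Ioi (0:ℝ))), ENNReal.ofReal (x ^ m * f x) =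
      ENNReal.ofReal (1 / Gamma α) *
        ∫⁻ v in Ioo (0:ℝ) x, ENNReal.ofReal ((x - v) ^ (α - 1)) * ENNReal.ofReal (f v) := by
  have hfm := h.1
  filter_upwards [h.ae_lintegral_Ioo_lt_top hα, ae_restrict_mem measurableSet_Ioi] with x hx hx0
  have hG := Gamma_pos_of_pos hα
  have e : ∫⁻ v in Ioo (0:ℝ) x, ENNReal.ofReal ((x - v) ^ (α - 1)) * ENNReal.ofReal (f v) =
      ∫⁻ v in Ioo (0:ℝ) x, ENNReal.ofReal ((x - v) ^ (α - 1) * f v) :=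
    setLIntegral_congr_fun measurableSet_Ioo fun v hv =>
      (ENNReal.ofReal_mul (rpow_nonneg (sub_nonneg.2 hv.2.le) _)).symm
  have hnn : 0 ≤ᵐ[volume.restrict (Ioo (0:ℝ) x)] fun v => (x - v) ^ (α - 1) * f v :=
    (ae_restrict_iff' measurableSet_Ioo).2 (Eventually.of_forall fun v hv =>
      mul_nonneg (rpow_nonneg (sub_nonneg.2 hv.2.le) _) (h.2.1 v hv.1))
  rw [e] at hx ⊢
  rw [h.2.2.2 x hx0, ENNReal.ofReal_mul (by positivity), ofReal_integral_eq_lintegral_ofReal _ hnn]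
  exact (lintegral_ofReal_ne_top_iff_integrable
    (Measurable.aestronglyMeasurable (by fun_prop)) hnn).1 hx.ne

/-- The functional equation of the Mellin transform of a density solution, without any
integrability assumption. -/
theorem lintegral_rpow_sub_eq (h : IsDensitySolution α m f) (hα : 0 < α) {u : ℝ} (hu : 0 < u) :
    ∫⁻ x in Ioi (0:ℝ), ENNReal.ofReal (x ^ (-(u - (m - α))) * f x) =
      ENNReal.ofReal (Gamma u / Gamma (α + u)) *
        ∫⁻ x in Ioi (0:ℝ), ENNReal.ofReal (x ^ (-u) * f x) := by
  have hfm := h.1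
  have hG := Gamma_pos_of_pos hα
  have hGu := Gamma_pos_of_pos hu
  have hGau := Gamma_pos_of_pos (add_pos hα hu)
  have hW : Measurable fun x : ℝ => ENNReal.ofReal (x ^ (-(α + u))) := by fun_prop
  have hk : Measurable fun x : ℝ => ENNReal.ofReal (x ^ (α - 1)) := by fun_prop
  have hg : Measurable fun x : ℝ => ENNReal.ofReal (f x) := by fun_prop
  have e : ∀ᵐ x ∂(volume.restrict (Ioi (0:ℝ))),
      ENNReal.ofReal (x ^ (-(u - (m - α))) * f x) = ENNReal.ofReal (1 / Gamma α) *
        (ENNReal.ofReal (x ^ (-(α + u))) *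
        ∫⁻ v in Ioo (0:ℝ) x, ENNReal.ofReal ((x - v) ^ (α - 1)) * ENNReal.ofReal (f v)) := by
    filter_upwards [h.ae_ofReal_rpow_mul_eq hα, ae_restrict_mem measurableSet_Ioi] with x hx hx0
    have hx0 : 0 < x := hx0
    rw [mul_left_comm, ← hx, ← ENNReal.ofReal_mul (by positivity), ← mul_assoc, ← rpow_add hx0]
    ring_nf
  rw [lintegral_congr_ae e, lintegral_const_mul' _ _ ENNReal.ofReal_ne_top,
    lintegral_mul_lintegral_Ioo_convolution hW hk hg,
    ← lintegral_const_mul' _ _ ENNReal.ofReal_ne_top,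
    ← lintegral_const_mul' _ _ ENNReal.ofReal_ne_top]
  refine setLIntegral_congr_fun measurableSet_Ioi fun v hv => ?_
  have hv : 0 < v := hv
  have hfv := h.2.1 v hv
  rw [lintegral_add_rpow_neg_mul_rpow_Ioi hα hu hv, ← ENNReal.ofReal_mul hfv,
    ← ENNReal.ofReal_mul (by positivity), ← ENNReal.ofReal_mul (by positivity)]
  congr 1
  field_simp

theorem integrableOn_iff (h : IsDensitySolution α m f) (s : ℝ) :
    IntegrableOn (fun x => x ^ (-s) * f x) (Ioi 0) ↔
      ∫⁻ x in Ioi (0:ℝ), ENNReal.ofReal (x ^ (-s) * f x) ≠ ⊤ := by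
  have hfm := h.1
  refine (lintegral_ofReal_ne_top_iff_integrable
    (Measurable.aestronglyMeasurable (by fun_prop)) ?_).symm
  exact (ae_restrict_iff' measurableSet_Ioi).2 (Eventually.of_forall fun x hx =>
    mul_nonneg (rpow_nonneg (le_of_lt hx) _) (h.2.1 x hx))

theorem integrableOn_sub_iff (h : IsDensitySolution α m f) (hα : 0 < α) {u : ℝ} (hu : 0 < u) :
    IntegrableOn (fun x => x ^ (-(u - (m - α))) * f x) (Ioi 0) ↔
      IntegrableOn (fun x => x ^ (-u) * f x) (Ioi 0) := by
  have hpos : 0 < Gamma u / Gamma (α + u) :=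
    div_pos (Gamma_pos_of_pos hu) (Gamma_pos_of_pos (add_pos hα hu))
  rw [h.integrableOn_iff, h.integrableOn_iff, h.lintegral_rpow_sub_eq hα hu, not_iff_not]
  simp [ENNReal.mul_eq_top, hpos]

/-- The functional equation of the Mellin transform of a density solution. -/
theorem integral_rpow_sub_eq (h : IsDensitySolution α m f) (hα : 0 < α) {u : ℝ} (hu : 0 < u) :
    ∫ x in Ioi (0:ℝ), x ^ (-(u - (m - α))) * f x =
      Gamma u / Gamma (α + u) * ∫ x in Ioi (0:ℝ), x ^ (-u) * f x := by
  have hfm := h.1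
  have hpos : 0 < Gamma u / Gamma (α + u) :=
    div_pos (Gamma_pos_of_pos hu) (Gamma_pos_of_pos (add_pos hα hu))
  have hnn : ∀ s : ℝ, 0 ≤ᵐ[volume.restrict (Ioi (0:ℝ))] fun x => x ^ (-s) * f x := fun s =>
    (ae_restrict_iff' measurableSet_Ioi).2 (Eventually.of_forall fun x hx =>
      mul_nonneg (rpow_nonneg (le_of_lt hx) _) (h.2.1 x hx))
  rw [integral_eq_lintegral_of_nonneg_ae (hnn _) (Measurable.aestronglyMeasurable (by fun_prop)),
    integral_eq_lintegral_of_nonneg_ae (hnn _) (Measurable.aestronglyMeasurable (by fun_prop)),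
    h.lintegral_rpow_sub_eq hα hu, ENNReal.toReal_mul, ENNReal.toReal_ofReal hpos.le]

theorem integrableOn_of_mem_Icc (h : IsDensitySolution α m f) {a b s : ℝ}
    (ha : IntegrableOn (fun x => x ^ (-a) * f x) (Ioi 0))
    (hb : IntegrableOn (fun x => x ^ (-b) * f x) (Ioi 0)) (hs : s ∈ Icc a b) :
    IntegrableOn (fun x => x ^ (-s) * f x) (Ioi 0) := by
  have hfm := h.1
  refine Integrable.mono' (ha.add hb) (Measurable.aestronglyMeasurable (by fun_prop)) ?_
  refine (ae_restrict_iff' measurableSet_Ioi).2 (Eventually.of_forall fun x hx => ?_)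
  have hx : 0 < x := hx
  have hfx := h.2.1 x hx
  rw [Real.norm_of_nonneg (by positivity)]
  simp only [Pi.add_apply]
  rw [← add_mul]
  gcongr
  rcases le_total 1 x with h1 | h1
  · have := rpow_le_rpow_of_exponent_le h1 (neg_le_neg hs.1)
    have : 0 < x ^ (-b) := by positivity
    linarith
  · have := rpow_le_rpow_of_exponent_ge hx h1 (neg_le_neg hs.2)
    have : 0 < x ^ (-a) := by positivity
    linarith

theorem integrableOn_nat_mul (h : IsDensitySolution α m f) (hα : α ∈ Ioo 0 m) (n : ℕ) :
    IntegrableOn (fun x => x ^ (-(n * (m - α))) * f x) (Ioi 0) := by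
  have hδ : 0 < m - α := sub_pos.2 hα.2
  induction n with
  | zero =>
    simpa using! Integrable.of_integral_ne_zero (by rw [h.2.2.1]; exact one_ne_zero)
  | succ n ih =>
    refine (h.integrableOn_sub_iff hα.1 (by positivity)).1 ?_
    convert ih using 5
    push_cast
    ring

theorem integrableOn_rpow (h : IsDensitySolution α m f) (hα : α ∈ Ioo 0 m) {s : ℝ}
    (hs : -(m - α) < s) : IntegrableOn (fun x => x ^ (-s) * f x) (Ioi 0) := by
  have hδ : 0 < m - α := sub_pos.2 hα.2
  have hnn : ∀ s : ℝ, 0 ≤ s → IntegrableOn (fun x => x ^ (-s) * f x) (Ioi 0) := by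
    intro s hs0
    obtain ⟨n, hn⟩ := exists_nat_ge (s / (m - α))
    have h0 := h.integrableOn_nat_mul hα 0
    rw [Nat.cast_zero, zero_mul] at h0
    exact h.integrableOn_of_mem_Icc h0 (h.integrableOn_nat_mul hα n)
      ⟨hs0, (div_le_iff₀ hδ).1 hn⟩
  have hs' : 0 < s + (m - α) := by linarith
  simpa using (h.integrableOn_sub_iff hα.1 hs').2 (hnn _ hs'.le)

theorem convexOn_mellin (h : IsDensitySolution α m f) (hα : α ∈ Ioo 0 m) :
    ConvexOn ℝ (Ioi (-(m - α))) fun s => ∫ x in Ioi (0:ℝ), x ^ (-s) * f x := by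
  refine ⟨convex_Ioi _, fun s hs t ht a b ha hb hab => ?_⟩
  have hst := convex_Ioi _ hs ht ha hb hab
  simp only [smul_eq_mul] at hst ⊢
  have is := h.integrableOn_rpow hα hs
  have it := h.integrableOn_rpow hα ht
  rw [← integral_const_mul, ← integral_const_mul, ← integral_add (is.const_mul a) (it.const_mul b)]
  refine setIntegral_mono_on (h.integrableOn_rpow hα hst)
    ((is.const_mul a).add (it.const_mul b)) measurableSet_Ioi fun x hx => ?_
  have hx0 : 0 < x := hx
  rw [← mul_assoc, ← mul_assoc, ← add_mul]
  refine mul_le_mul_of_nonneg_right ?_ (h.2.1 x hx)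
  have := convexOn_exp.2 (mem_univ (log x * -s)) (mem_univ (log x * -t)) ha hb hab
  simp only [smul_eq_mul] at this
  rw [rpow_def_of_pos hx0, rpow_def_of_pos hx0, rpow_def_of_pos hx0]
  convert this using 2
  ring

end IsDensitySolution

/-- As `α → 0+` (with `m > 0` fixed), the Mellin transform of the density
solution with parameters `(m, α)` converges to `1` at every fixed `s > −m`;
that is, the corresponding random variable converges in distribution to `1`. -/
theorem density_solution_limit_alpha_zero (m : ℝ) (hm : 0 < m)
    (f : ℝ → ℝ → ℝ)
    (hf : ∀ α ∈ Set.Ioo (0:ℝ) m, IsDensitySolution α m (f α)) :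
    ∀ s : ℝ, -m < s →
      Filter.Tendsto (fun α : ℝ => ∫ x in Set.Ioi (0:ℝ), x ^ (-s) * f α x)
        (nhdsWithin 0 (Set.Ioi (0:ℝ))) (nhds 1) := by
  intro s hs
  set M : ℝ → ℝ → ℝ := fun α s => ∫ x in Ioi (0:ℝ), x ^ (-s) * f α x with hM
  have hmem : ∀ᶠ α in nhdsWithin (0:ℝ) (Ioi 0), α ∈ Ioo (0:ℝ) m := Ioo_mem_nhdsGT hm
  have hα : Tendsto (fun α : ℝ => α) (nhdsWithin (0:ℝ) (Ioi 0)) (nhds 0) :=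
    tendsto_nhdsWithin_of_tendsto_nhds tendsto_id
  have hδ : Tendsto (fun α : ℝ => m - α) (nhdsWithin (0:ℝ) (Ioi 0)) (nhds m) := by
    simpa using hα.const_sub m
  have hGamma : ∀ {a : ℝ}, 0 < a → ContinuousAt Gamma a := fun {a} ha =>
    (differentiableAt_Gamma fun k => by
      have : (0:ℝ) ≤ k := k.cast_nonneg
      linarith).continuousAt
  have hnat : ∀ n : ℕ, Tendsto (fun α => M α (n * (m - α))) (nhdsWithin (0:ℝ) (Ioi 0))
      (nhds 1) := by
    intro n
    induction n with
    | zero =>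
      refine tendsto_const_nhds.congr' ?_
      filter_upwards [hmem] with α h
      simp [hM, (hf α h).2.2.1]
    | succ n ih =>
      have hpos : 0 < ((n + 1 : ℕ) : ℝ) * m := by positivity
      have hl : Tendsto (fun α : ℝ => ((n + 1 : ℕ) : ℝ) * (m - α)) (nhdsWithin (0:ℝ) (Ioi 0))
          (nhds (((n + 1 : ℕ) : ℝ) * m)) := hδ.const_mul _
      have hl' : Tendsto (fun α : ℝ => α + ((n + 1 : ℕ) : ℝ) * (m - α))
          (nhdsWithin (0:ℝ) (Ioi 0)) (nhds (((n + 1 : ℕ) : ℝ) * m)) := by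
        simpa using hα.add hl
      have hlim := (((hGamma hpos).tendsto.comp hl').div ((hGamma hpos).tendsto.comp hl)
        (Gamma_pos_of_pos hpos).ne').mul ih
      rw [div_self (Gamma_pos_of_pos hpos).ne', one_mul] at hlim
      refine hlim.congr' ?_
      filter_upwards [hmem] with α h
      have hu : 0 < ((n + 1 : ℕ) : ℝ) * (m - α) := mul_pos (by positivity) (sub_pos.2 h.2)
      have hrec := (hf α h).integral_rpow_sub_eq h.1 hu
      have hG := Gamma_pos_of_pos hu
      have hG' := Gamma_pos_of_pos (add_pos h.1 hu)
      have he : ((n + 1 : ℕ) : ℝ) * (m - α) - (m - α) = n * (m - α) := by push_cast; ring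
      rw [he] at hrec
      simp only [hM, Pi.div_apply, Function.comp_apply]
      rw [hrec]
      field_simp
  obtain ⟨N, hN⟩ := exists_nat_gt (|s| / (m / 2))
  rw [div_lt_iff₀ (by positivity)] at hN
  have hsN : ∀ᶠ α in nhdsWithin (0:ℝ) (Ioi 0), |s| < N * (m - α) :=
    (hδ.const_mul (N : ℝ)).eventually_const_lt (by nlinarith [abs_nonneg s])
  have hlower : Tendsto (fun α => M α (N * (m - α)) - (N * (m - α) - s) / (m - α) *
      (M α ((N + 1 : ℕ) * (m - α)) - M α (N * (m - α)))) (nhdsWithin (0:ℝ) (Ioi 0))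
      (nhds 1) := by
    have := (hnat N).sub ((((hδ.const_mul (N : ℝ)).sub_const s).div hδ hm.ne').mul
      ((hnat (N + 1)).sub (hnat N)))
    simpa using this
  have hle : ∀ᶠ α in nhdsWithin (0:ℝ) (Ioi 0), M α (N * (m - α)) -
      (N * (m - α) - s) / (m - α) * (M α ((N + 1 : ℕ) * (m - α)) - M α (N * (m - α))) ≤
      M α s := by
    filter_upwards [hmem, hsN, hδ.eventually_const_lt (show -s < m by linarith)] with α h h1 h2
    have hd : 0 < m - α := sub_pos.2 h.2
    have hy : s < N * (m - α) := (le_abs_self s).trans_lt h1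
    have hz : (N : ℝ) * (m - α) < (N + 1 : ℕ) * (m - α) := by push_cast; linarith
    have hslope := ((hf α h).convexOn_mellin h).slope_mono_adjacent (x := s)
      (y := N * (m - α)) (z := (N + 1 : ℕ) * (m - α)) (by simp only [mem_Ioi]; linarith)
      (by simp only [mem_Ioi]; linarith [abs_nonneg s]) hy hz
    have hden : ((N + 1 : ℕ) : ℝ) * (m - α) - N * (m - α) = m - α := by push_cast; ring
    rw [hden, div_le_iff₀ (sub_pos.2 hy), div_mul_comm] at hslope
    simp only [hM]
    linarith
  have hmax : ∀ n : ℕ, Tendsto (fun α => max (M α ((0 : ℕ) * (m - α))) (M α (n * (m - α))))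
      (nhdsWithin (0:ℝ) (Ioi 0)) (nhds 1) := fun n => by
    simpa using (hnat 0).max (hnat n)
  have hle_max : ∀ (n : ℕ) (α t : ℝ), α ∈ Ioo 0 m → 0 ≤ t → t ≤ n * (m - α) →
      M α t ≤ max (M α ((0 : ℕ) * (m - α))) (M α (n * (m - α))) := by
    intro n α t h h0 ht
    have hd : 0 < m - α := sub_pos.2 h.2
    refine ((hf α h).convexOn_mellin h).le_max_of_mem_Icc ?_ ?_ ⟨by simpa using h0, ht⟩
    · simpa using h.2
    · simp only [mem_Ioi]
      linarith
  rcases le_or_gt 0 s with hs0 | hs0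
  · refine tendsto_of_tendsto_of_tendsto_of_le_of_le' hlower (hmax N) hle ?_
    filter_upwards [hmem, hsN] with α h h1
    exact hle_max N α s h hs0 ((le_abs_self s).trans h1.le)
  · have hpos : 0 < s + m := by linarith
    have hl : Tendsto (fun α : ℝ => s + (m - α)) (nhdsWithin (0:ℝ) (Ioi 0))
        (nhds (s + m)) := hδ.const_add s
    have hl' : Tendsto (fun α : ℝ => α + (s + (m - α))) (nhdsWithin (0:ℝ) (Ioi 0))
        (nhds (s + m)) := by
      simpa using hα.add hl
    have hupper := (((hGamma hpos).tendsto.comp hl).div ((hGamma hpos).tendsto.comp hl')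
      (Gamma_pos_of_pos hpos).ne').mul (hmax 1)
    rw [div_self (Gamma_pos_of_pos hpos).ne', one_mul] at hupper
    refine tendsto_of_tendsto_of_tendsto_of_le_of_le' hlower hupper hle ?_
    filter_upwards [hmem, hl.eventually_const_lt hpos] with α h hu
    have hrec := (hf α h).integral_rpow_sub_eq h.1 hu
    rw [add_sub_cancel_right] at hrec
    rw [hrec]
    refine mul_le_mul_of_nonneg_left (hle_max 1 α _ h hu.le (by push_cast; linarith)) ?_
    exact (div_pos (Gamma_pos_of_pos hu) (Gamma_pos_of_pos (add_pos h.1 hu))).le
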